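/- For integers k ≥ 2 and d ≥ k + 1, and every positive integer N, one has ∫_ℝ (v(ξ))^d e^{-2πi ξ N} dξ = (Γ(1 + 1/k)^d / Γ(d/k)) · N^{d/k - 1}, where v(ξ) = ∫_0^{N^{1/k}} e^{2πi ξ z^k} dz. -/

import Mathlib

noncomputable def e (x : ℝ) : ℂ := Complex.exp (2 * Real.pi * Complex.I * x)

noncomputable def oscInt (k : ℕ) (X : ℝ) (ξ : ℝ) : ℂ := ∫ z in (0:ℝ)..X, e (ξ * z ^ k)

open MeasureTheory Set Filter Topology FourierTransform Convolution

theorem norm_e (x : ℝ) : ‖e x‖ = 1 := by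
  rw [e, show (2 * Real.pi * Complex.I * x : ℂ) = ((2 * Real.pi * x : ℝ) : ℂ) * Complex.I by
    push_cast; ring]
  exact Complex.norm_exp_ofReal_mul_I _

theorem continuous_e : Continuous e := by
  unfold e
  fun_prop

/-- First derivative test: a decreasing nonnegative amplitude against the derivative of a
bounded function. -/
theorem norm_integral_mul_deriv_le {u u' : ℝ → ℝ} {v v' : ℝ → ℂ} {a b M : ℝ} (hab : a ≤ b)
    (hu : ∀ x ∈ Icc a b, HasDerivAt u (u' x) x) (hv : ∀ x ∈ Icc a b, HasDerivAt v (v' x) x)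
    (hu' : ContinuousOn u' (Icc a b)) (hv' : ContinuousOn v' (Icc a b))
    (hneg : ∀ x ∈ Icc a b, u' x ≤ 0) (hub : 0 ≤ u b) (hM : ∀ x ∈ Icc a b, ‖v x‖ ≤ M) :
    ‖∫ x in a..b, (u x : ℂ) * v' x‖ ≤ 2 * M * u a := by
  rw [← uIcc_of_le hab] at hu hv hu' hv'
  have hint : IntervalIntegrable u' volume a b := hu'.intervalIntegrable
  have hftc : ∫ x in a..b, u' x = u b - u a := intervalIntegral.integral_eq_sub_of_hasDerivAt hu hint
  have hM0 : 0 ≤ M := (norm_nonneg _).trans (hM a (left_mem_Icc.2 hab))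
  have hle : u b ≤ u a := by
    have : 0 ≤ ∫ x in a..b, -u' x :=
      intervalIntegral.integral_nonneg hab fun x hx => neg_nonneg.2 (hneg x hx)
    rw [intervalIntegral.integral_neg, hftc] at this
    linarith
  have hrest : ‖∫ x in a..b, (u' x : ℂ) * v x‖ ≤ M * (u a - u b) := by
    calc ‖∫ x in a..b, (u' x : ℂ) * v x‖ ≤ ∫ x in a..b, M * (-u' x) := by
          refine intervalIntegral.norm_integral_le_of_norm_le hab (ae_of_all _ fun x hx => ?_)
            (hint.neg.const_mul M)
          have hx' : x ∈ Icc a b := Ioc_subset_Icc_self hx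
          rw [norm_mul, Complex.norm_real, Real.norm_of_nonpos (hneg x hx'), mul_comm]
          exact mul_le_mul_of_nonneg_right (hM x hx') (neg_nonneg.2 (hneg x hx'))
      _ = M * (u a - u b) := by
          rw [intervalIntegral.integral_const_mul, intervalIntegral.integral_neg, hftc]
          ring
  rw [intervalIntegral.integral_mul_deriv_eq_deriv_mul (fun x hx => (hu x hx).ofReal_comp) hv
    (Complex.continuous_ofReal.comp_continuousOn hu').intervalIntegrable hv'.intervalIntegrable]
  have hb : ‖(u b : ℂ) * v b‖ ≤ M * u b := by
    rw [norm_mul, Complex.norm_real, Real.norm_of_nonneg hub, mul_comm]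
    exact mul_le_mul_of_nonneg_right (hM b (right_mem_Icc.2 hab)) hub
  have ha : ‖(u a : ℂ) * v a‖ ≤ M * u a := by
    rw [norm_mul, Complex.norm_real, Real.norm_of_nonneg (hub.trans hle), mul_comm]
    exact mul_le_mul_of_nonneg_right (hM a (left_mem_Icc.2 hab)) (hub.trans hle)
  calc _ ≤ ‖(u b : ℂ) * v b - u a * v a‖ + ‖∫ x in a..b, (u' x : ℂ) * v x‖ := norm_sub_le _ _
    _ ≤ (M * u b + M * u a) + M * (u a - u b) :=
        add_le_add ((norm_sub_le _ _).trans (add_le_add hb ha)) hrest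
    _ = 2 * M * u a := by ring

theorem hasDerivAt_e_mul_pow (k : ℕ) (ξ z : ℝ) :
    HasDerivAt (fun z : ℝ => e (ξ * z ^ k))
      (e (ξ * z ^ k) * (2 * Real.pi * Complex.I * (ξ * (k * z ^ (k - 1))))) z := by
  have h : HasDerivAt (fun z : ℝ => ξ * z ^ k) (ξ * (k * z ^ (k - 1))) z :=
    (hasDerivAt_pow k z).const_mul ξ
  have h2 := (h.ofReal_comp.const_mul (2 * Real.pi * Complex.I)).cexp
  simpa [e] using h2

theorem norm_integral_e_mul_pow_le {k : ℕ} (hk : 1 ≤ k) {ξ δ X : ℝ} (hξ : ξ ≠ 0) (hδ : 0 < δ)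
    (hδX : δ ≤ X) :
    ‖∫ z in δ..X, e (ξ * z ^ k)‖ ≤ (|ξ| * δ ^ (k - 1))⁻¹ := by
  have hpos : ∀ z ∈ Icc δ X, 0 < z := fun z hz => hδ.trans_le hz.1
  have hk0 : (k : ℂ) ≠ 0 := by exact_mod_cast (by omega : k ≠ 0)
  have hk1 : (1 : ℝ) ≤ k := by exact_mod_cast hk
  have hξ0 : (ξ : ℂ) ≠ 0 := by exact_mod_cast hξ
  set c : ℂ := (2 * Real.pi * Complex.I * (ξ * k))⁻¹ with hc
  have hc0 : 2 * Real.pi * Complex.I * (ξ * k) * c = 1 := mul_inv_cancel₀ (by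
    simp [Real.pi_ne_zero, hξ0, hk0])
  have hnc : 2 * ‖c‖ ≤ |ξ|⁻¹ := by
    have : ‖c‖ = (2 * Real.pi * (|ξ| * k))⁻¹ := by
      rw [hc, norm_inv]
      simp [abs_of_pos Real.pi_pos]
    have hx : 0 < |ξ| := abs_pos.2 hξ
    rw [this, ← div_eq_mul_inv, div_le_iff₀ (by positivity)]
    have : |ξ|⁻¹ * (2 * Real.pi * (|ξ| * k)) = 2 * (Real.pi * k) := by field_simp
    rw [this]
    nlinarith [Real.pi_gt_three]
  have hmain := norm_integral_mul_deriv_le (u := fun z => (z ^ (k - 1))⁻¹)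
    (u' := fun z => -(((k - 1 : ℕ) : ℝ) * z ^ (k - 1 - 1)) / (z ^ (k - 1)) ^ 2)
    (v := fun z => e (ξ * z ^ k) * c)
    (v' := fun z => e (ξ * z ^ k) * (2 * Real.pi * Complex.I * (ξ * (k * z ^ (k - 1)))) * c)
    (M := ‖c‖) hδX
    (fun z hz => (hasDerivAt_pow (k - 1) z).fun_inv (pow_pos (hpos z hz) _).ne')
    (fun z _ => (hasDerivAt_e_mul_pow k ξ z).mul_const c)
    (ContinuousOn.div (by fun_prop) (by fun_prop) fun z hz => by
      have := hpos z hz; positivity)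
    (by have := continuous_e; fun_prop)
    (fun z hz => by
      have := hpos z hz
      rw [neg_div]
      exact neg_nonpos.2 (by positivity))
    (by have := hδ.trans_le hδX; positivity)
    (fun z _ => by rw [norm_mul, norm_e, one_mul])
  calc ‖∫ z in δ..X, e (ξ * z ^ k)‖ = _ := by
        congr 1
        refine intervalIntegral.integral_congr fun z hz => ?_
        rw [uIcc_of_le hδX] at hz
        have hz0 : (z : ℂ) ^ (k - 1) ≠ 0 := by
          exact_mod_cast (pow_pos (hpos z hz) (k - 1)).ne'
        have : ((z ^ (k - 1))⁻¹ : ℂ) * (e (ξ * z ^ k) *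
            (2 * Real.pi * Complex.I * (ξ * (k * z ^ (k - 1)))) * c) =
            e (ξ * z ^ k) * (((z : ℂ) ^ (k - 1))⁻¹ * (z : ℂ) ^ (k - 1)) *
              (2 * Real.pi * Complex.I * (ξ * k) * c) := by ring
        simp only [Complex.ofReal_inv, Complex.ofReal_pow]
        rw [this, hc0, inv_mul_cancel₀ hz0, mul_one, mul_one]
    _ ≤ 2 * ‖c‖ * (δ ^ (k - 1))⁻¹ := hmain
    _ ≤ |ξ|⁻¹ * (δ ^ (k - 1))⁻¹ := mul_le_mul_of_nonneg_right hnc (by positivity)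
    _ = _ := (mul_inv _ _).symm

theorem norm_oscInt_le (k : ℕ) {X : ℝ} (hX : 0 ≤ X) (ξ : ℝ) : ‖oscInt k X ξ‖ ≤ X := by
  have := intervalIntegral.norm_integral_le_of_norm_le_const (a := 0) (b := X) (C := 1)
    (f := fun z => e (ξ * z ^ k)) fun z _ => (norm_e _).le
  simpa [oscInt, abs_of_nonneg hX] using this

theorem norm_oscInt_le_rpow {k : ℕ} (hk : 1 ≤ k) {X : ℝ} (hX : 0 ≤ X) (ξ : ℝ) :
    ‖oscInt k X ξ‖ ≤ (2 * X + 3) * (1 + |ξ|) ^ (-(1 / k : ℝ)) := by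
  have hk0 : (k : ℝ) ≠ 0 := by exact_mod_cast (by omega : k ≠ 0)
  have hk1 : (1 : ℝ) ≤ k := by exact_mod_cast hk
  have h1 : 0 < 1 + |ξ| := by positivity
  set δ : ℝ := (1 + |ξ|) ^ (-(1 / k : ℝ)) with hδdef
  have hδ : 0 < δ := Real.rpow_pos_of_pos h1 _
  have hδk : δ ^ k = (1 + |ξ|)⁻¹ := by
    rw [hδdef, ← Real.rpow_natCast, ← Real.rpow_mul h1.le, neg_mul, one_div_mul_cancel hk0,
      Real.rpow_neg_one]
  rcases le_total |ξ| 1 with hξ | hξ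
  · have : 1 / 2 ≤ δ := by
      calc (1 / 2 : ℝ) ≤ (1 + |ξ|)⁻¹ := by
            rw [one_div]; exact inv_anti₀ h1 (by linarith)
        _ = (1 + |ξ|) ^ (-1 : ℝ) := (Real.rpow_neg_one _).symm
        _ ≤ δ := Real.rpow_le_rpow_of_exponent_le (by linarith [abs_nonneg ξ])
            (neg_le_neg (by rw [one_div]; exact inv_le_one_of_one_le₀ hk1))
    calc _ ≤ X := norm_oscInt_le k hX ξ
      _ ≤ (2 * X + 3) * δ := by nlinarith
  · have hξ0 : ξ ≠ 0 := by
      rintro rfl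
      simp at hξ
      linarith
    rcases le_total X δ with hXδ | hδX
    · calc _ ≤ X := norm_oscInt_le k hX ξ
        _ ≤ (2 * X + 3) * δ := by nlinarith
    · have hcont : Continuous fun z : ℝ => e (ξ * z ^ k) := continuous_e.comp (by fun_prop)
      have hsplit : oscInt k X ξ = oscInt k δ ξ + ∫ z in δ..X, e (ξ * z ^ k) :=
        (intervalIntegral.integral_add_adjacent_intervals (hcont.intervalIntegrable _ _)
          (hcont.intervalIntegrable _ _)).symm
      have hsecond : (|ξ| * δ ^ (k - 1))⁻¹ ≤ 2 * δ := by
        have hd : δ ^ (k - 1) * δ = (1 + |ξ|)⁻¹ := by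
          rw [← hδk, ← pow_succ, Nat.sub_add_cancel hk]
        have hx : 0 < |ξ| := by linarith
        rw [inv_le_iff_one_le_mul₀ (by positivity)]
        calc (1 : ℝ) = (1 + |ξ|) * (1 + |ξ|)⁻¹ := (mul_inv_cancel₀ h1.ne').symm
          _ ≤ (2 * |ξ|) * (1 + |ξ|)⁻¹ :=
              mul_le_mul_of_nonneg_right (by linarith) (by positivity)
          _ = 2 * δ * (|ξ| * δ ^ (k - 1)) := by rw [← hd]; ring
      rw [hsplit]
      calc _ ≤ δ + 2 * δ := (norm_add_le _ _).trans (add_le_add (norm_oscInt_le k hδ.le ξ)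
            ((norm_integral_e_mul_pow_le hk hξ0 hδ hδX).trans hsecond))
        _ ≤ (2 * X + 3) * δ := by nlinarith [mul_nonneg hX hδ.le]

theorem continuous_oscInt (k : ℕ) (X : ℝ) : Continuous (oscInt k X) :=
  intervalIntegral.continuous_parametric_intervalIntegral_of_continuous'
    (f := fun ξ z => e (ξ * z ^ k)) (continuous_e.comp (by fun_prop)) _ _

theorem integrable_oscInt_pow {k d : ℕ} (hk : 1 ≤ k) (hd : k < d) {X : ℝ} (hX : 0 ≤ X) :
    Integrable fun ξ => oscInt k X ξ ^ d := by
  have hk0 : (0 : ℝ) < k := by exact_mod_cast hk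
  have hr : ((Module.finrank ℝ ℝ : ℕ) : ℝ) < d / k := by
    rw [Module.finrank_self, Nat.cast_one, one_lt_div hk0]
    exact_mod_cast hd
  refine ((integrable_one_add_norm (μ := (volume : Measure ℝ)) hr).const_mul
    ((2 * X + 3) ^ d)).mono' ((continuous_oscInt k X).pow d).aestronglyMeasurable
    (ae_of_all _ fun ξ => ?_)
  have h1 : 0 ≤ 1 + |ξ| := by positivity
  rw [norm_pow, Real.norm_eq_abs]
  refine (pow_le_pow_left₀ (norm_nonneg _) (norm_oscInt_le_rpow hk hX ξ) d).trans_eq ?_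
  rw [mul_pow, ← Real.rpow_natCast ((1 + |ξ|) ^ _), ← Real.rpow_mul h1]
  congr 2
  ring
/-- `F` vanishes on `(-∞, 0]` and is `A` times the normalized power `t ^ (a - 1) / Γ(a)`
on `(0, T)`. -/
def IsGammaPowerOn (T A a : ℝ) (F : ℝ → ℂ) : Prop :=
  (∀ t ≤ 0, F t = 0) ∧ ∀ t ∈ Ioo 0 T, F t = ((A / Real.Gamma a * t ^ (a - 1) : ℝ) : ℂ)

theorem integral_rpow_mul_sub_rpow {a b t : ℝ} (ha : 0 < a) (hb : 0 < b) (ht : 0 < t) :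
    ∫ s in (0 : ℝ)..t, ((s ^ (a - 1) * (t - s) ^ (b - 1) : ℝ) : ℂ) =
      ((Real.Gamma a * Real.Gamma b / Real.Gamma (a + b) * t ^ (a + b - 1) : ℝ) : ℂ) := by
  have hΓ := Complex.Gamma_mul_Gamma_eq_betaIntegral (s := a) (t := b) (by simpa) (by simpa)
  have hne : (Real.Gamma (a + b) : ℂ) ≠ 0 := by
    exact_mod_cast (Real.Gamma_pos_of_pos (add_pos ha hb)).ne'
  have hscale := Complex.betaIntegral_scaled a b ht
  rw [← Complex.ofReal_add, Complex.Gamma_ofReal, Complex.Gamma_ofReal, Complex.Gamma_ofReal]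
    at hΓ
  have hbeta : Complex.betaIntegral a b =
      Real.Gamma a * Real.Gamma b / Real.Gamma (a + b) := by
    rw [hΓ, mul_div_cancel_left₀ _ hne]
  rw [hbeta] at hscale
  calc _ = ∫ s in (0 : ℝ)..t, (s : ℂ) ^ ((a : ℂ) - 1) * ((t : ℂ) - s) ^ ((b : ℂ) - 1) := by
        refine intervalIntegral.integral_congr fun s hs => ?_
        rw [uIcc_of_le ht.le] at hs
        rw [Complex.ofReal_mul, Complex.ofReal_cpow hs.1, Complex.ofReal_cpow (sub_nonneg.2 hs.2)]
        push_cast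
        rfl
    _ = _ := by
        rw [hscale, Complex.ofReal_mul, Complex.ofReal_cpow ht.le]
        push_cast
        ring

theorem IsGammaPowerOn.convolution {T A B a b : ℝ} {F G : ℝ → ℂ} (ha : 0 < a) (hb : 0 < b)
    (hF : IsGammaPowerOn T A a F) (hG : IsGammaPowerOn T B b G) :
    IsGammaPowerOn T (A * B) (a + b) (F ⋆[ContinuousLinearMap.mul ℂ ℂ] G) := by
  constructor
  · intro t ht
    refine integral_eq_zero_of_ae (ae_of_all _ fun s => ?_)
    simp only [ContinuousLinearMap.mul_apply', Pi.zero_apply]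
    rcases le_total s 0 with hs | hs
    · rw [hF.1 s hs, zero_mul]
    · rw [hG.1 (t - s) (by linarith), mul_zero]
  · intro t ht
    have hΓa := (Real.Gamma_pos_of_pos ha).ne'
    have hΓb := (Real.Gamma_pos_of_pos hb).ne'
    calc ∫ s, F s * G (t - s) = ∫ s in Ioo 0 t, F s * G (t - s) := by
          refine (setIntegral_eq_integral_of_forall_compl_eq_zero fun s hs => ?_).symm
          rcases le_or_gt s 0 with h | h
          · rw [hF.1 s h, zero_mul]
          · rw [hG.1 (t - s) (by by_contra! h'; exact hs ⟨h, by linarith⟩), mul_zero]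
      _ = ∫ s in Ioo 0 t, ((A / Real.Gamma a * (B / Real.Gamma b) : ℝ) : ℂ) *
            ((s ^ (a - 1) * (t - s) ^ (b - 1) : ℝ) : ℂ) := by
          refine setIntegral_congr_fun measurableSet_Ioo fun s hs => ?_
          rw [hF.2 s ⟨hs.1, hs.2.trans ht.2⟩,
            hG.2 (t - s) ⟨by linarith [hs.2], by linarith [hs.1, ht.2]⟩]
          push_cast
          ring
      _ = _ := by
          rw [integral_const_mul, ← integral_Ioc_eq_integral_Ioo,
            ← intervalIntegral.integral_of_le ht.1.le, integral_rpow_mul_sub_rpow ha hb ht.1,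
            ← Complex.ofReal_mul]
          congr 1
          field_simp

theorem exists_fourier_eq_pow {T A a : ℝ} {f : ℝ → ℂ} (ha : 0 < a) (hfi : Integrable f)
    (hf : IsGammaPowerOn T A a f) (n : ℕ) :
    ∃ F : ℝ → ℂ, Integrable F ∧ (∀ ξ, 𝓕 F ξ = 𝓕 f ξ ^ (n + 1)) ∧
      IsGammaPowerOn T (A ^ (n + 1)) ((n + 1 : ℕ) * a) F := by
  induction n with
  | zero => exact ⟨f, hfi, by simp, by simpa using hf⟩
  | succ n ih =>
    obtain ⟨F, hFi, hFF, hF⟩ := ih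
    refine ⟨F ⋆[ContinuousLinearMap.mul ℂ ℂ] f, hFi.integrable_convolution _ hfi, fun ξ => ?_, ?_⟩
    · rw [Real.fourier_mul_convolution_eq hFi hfi, hFF, ← pow_succ]
    · have := hF.convolution (by positivity) ha hf
      rwa [← pow_succ, show ((n + 1 : ℕ) : ℝ) * a + a = ((n + 1 + 1 : ℕ) : ℝ) * a by
        push_cast; ring] at this

theorem IsGammaPowerOn.fourierInv_fourier_eq {T A a : ℝ} {F : ℝ → ℂ} (hT : 0 < T)
    (hF : IsGammaPowerOn T A a F) (hFi : Integrable F) (hFF : Integrable (𝓕 F)) :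
    𝓕⁻ (𝓕 F) T = ((A / Real.Gamma a * T ^ (a - 1) : ℝ) : ℂ) := by
  have hcont : Continuous (𝓕⁻ (𝓕 F)) := by
    rw [Real.fourierInv_eq_fourier_comp_neg]
    exact VectorFourier.fourierIntegral_continuous Real.continuous_fourierChar
      (innerSL ℝ).continuous₂ hFF.comp_neg
  have hpow : ∀ t > 0, ContinuousAt (fun t : ℝ => ((A / Real.Gamma a * t ^ (a - 1) : ℝ) : ℂ)) t :=
    fun t ht => Complex.continuous_ofReal.continuousAt.comp
      (continuousAt_const.mul (Real.continuousAt_rpow_const _ _ (Or.inl ht.ne')))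
  have heq : ∀ t ∈ Ioo 0 T, 𝓕⁻ (𝓕 F) t = ((A / Real.Gamma a * t ^ (a - 1) : ℝ) : ℂ) := by
    intro t ht
    rw [← hF.2 t ht]
    refine hFi.fourierInv_fourier_eq hFF ((hpow t ht.1).congr ?_)
    filter_upwards [Ioo_mem_nhds ht.1 ht.2] with s hs using (hF.2 s hs).symm
  refine tendsto_nhds_unique ((hcont.tendsto T).mono_left (nhdsWithin_le_nhds (s := Iio T)))
    (((hpow T hT).tendsto.mono_left nhdsWithin_le_nhds).congr' ?_)
  filter_upwards [Ioo_mem_nhdsLT hT] with t ht using (heq t ht).symm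

/-- The density of the image of Lebesgue measure on `(0, T ^ (1 / k))` under `z ↦ z ^ k`. -/
noncomputable def powDensity (k : ℕ) (T : ℝ) : ℝ → ℂ :=
  (Ioo 0 T).indicator fun t => (((1 / k : ℝ) * t ^ (1 / k - 1 : ℝ) : ℝ) : ℂ)

theorem integrable_powDensity {k : ℕ} (hk : 1 ≤ k) {T : ℝ} (hT : 0 ≤ T) :
    Integrable (powDensity k T) := by
  have hk0 : (0 : ℝ) < k := by exact_mod_cast hk
  have h : IntervalIntegrable (fun t : ℝ => t ^ (1 / k - 1 : ℝ)) volume 0 T :=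
    intervalIntegral.intervalIntegrable_rpow' (by linarith [one_div_pos.2 hk0])
  rw [powDensity, integrable_indicator_iff measurableSet_Ioo]
  exact (((intervalIntegrable_iff_integrableOn_Ioo_of_le hT).1 h).const_mul _).ofReal

theorem isGammaPowerOn_powDensity {k : ℕ} (hk : 1 ≤ k) (T : ℝ) :
    IsGammaPowerOn T (Real.Gamma (1 + 1 / k)) (1 / k) (powDensity k T) := by
  have hk0 : (0 : ℝ) < 1 / k := one_div_pos.2 (by exact_mod_cast hk)
  refine ⟨fun t ht => indicator_of_notMem (fun h => h.1.not_ge ht) _, fun t ht => ?_⟩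
  rw [powDensity, indicator_of_mem ht, add_comm, Real.Gamma_add_one hk0.ne',
    mul_div_cancel_right₀ _ (Real.Gamma_pos_of_pos hk0).ne']

theorem fourier_powDensity {k : ℕ} (hk : 1 ≤ k) {T : ℝ} (hT : 0 ≤ T) (ξ : ℝ) :
    𝓕 (powDensity k T) (-ξ) = oscInt k (T ^ (1 / k : ℝ)) ξ := by
  have hk0 : (0 : ℝ) < 1 / k := one_div_pos.2 (by exact_mod_cast hk)
  have hk1 : (k : ℝ) ≠ 0 := by exact_mod_cast (by omega : k ≠ 0)
  have hsub := integral_comp_rpow_Ioi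
    ((Iio (T ^ (1 / k : ℝ))).indicator fun z : ℝ => e (ξ * z ^ k)) hk0.ne'
  rw [setIntegral_indicator measurableSet_Iio, Ioi_inter_Iio, ← integral_Ioc_eq_integral_Ioo,
    ← intervalIntegral.integral_of_le (Real.rpow_nonneg hT _)] at hsub
  rw [oscInt, ← hsub, Real.fourier_real_eq_integral_exp_smul, ← integral_indicator measurableSet_Ioi]
  congr 1 with t
  by_cases ht : 0 < t
  · rw [indicator_of_mem (mem_Ioi.2 ht), abs_of_pos hk0]
    by_cases htT : t < T
    · rw [powDensity, indicator_of_mem (show t ∈ Ioo 0 T from ⟨ht, htT⟩),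
        indicator_of_mem (mem_Iio.2 (Real.rpow_lt_rpow ht.le htT hk0)), ← Real.rpow_natCast,
        ← Real.rpow_mul ht.le, one_div_mul_cancel hk1, Real.rpow_one, Complex.real_smul,
        smul_eq_mul, mul_comm, e]
      congr 2
      push_cast
      ring
    · rw [powDensity, indicator_of_notMem fun h => htT h.2, indicator_of_notMem fun h =>
        htT ((Real.rpow_lt_rpow_iff ht.le hT hk0).1 (mem_Iio.1 h)), smul_zero, smul_zero]
  · rw [powDensity, indicator_of_notMem fun h => ht h.1, indicator_of_notMem fun h => ht (mem_Ioi.1 h),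
      smul_zero]

theorem singular_integral_eval (k d : ℕ) (hk : 2 ≤ k) (hd : k + 1 ≤ d) (N : ℕ) (hN : 1 ≤ N) :
    ∫ ξ : ℝ, (oscInt k ((N : ℝ) ^ ((1 : ℝ) / k)) ξ) ^ d * e (-(ξ * N)) =
      ((Real.Gamma (1 + 1 / k) ^ d / Real.Gamma (d / k) : ℝ) : ℂ) *
        ((N : ℝ) ^ ((d : ℝ) / k - 1) : ℝ) := by
  have hk1 : 1 ≤ k := by omega
  have hN0 : (0 : ℝ) < N := by exact_mod_cast hN
  have hk0 : (0 : ℝ) < 1 / k := one_div_pos.2 (by exact_mod_cast hk1)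
  obtain ⟨n, rfl⟩ : ∃ n, d = n + 1 := ⟨d - 1, by omega⟩
  obtain ⟨F, hFi, hFF, hF⟩ := exists_fourier_eq_pow hk0 (integrable_powDensity hk1 hN0.le)
    (isGammaPowerOn_powDensity hk1 N) n
  have hF_osc : ∀ ξ, 𝓕 F (-ξ) = oscInt k ((N : ℝ) ^ ((1 : ℝ) / k)) ξ ^ (n + 1) := fun ξ => by
    rw [hFF, fourier_powDensity hk1 hN0.le]
  have hFint : Integrable (𝓕 F) := by
    have h := integrable_oscInt_pow hk1 (Nat.lt_of_succ_le hd)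
      (Real.rpow_nonneg hN0.le ((1 : ℝ) / k))
    simpa only [← hF_osc, neg_neg] using h.comp_neg
  calc _ = ∫ ξ : ℝ, 𝓕 F (-ξ) * e (-ξ * N) := by simp only [hF_osc, neg_mul]
    _ = ∫ ξ : ℝ, 𝓕 F ξ * e (ξ * N) := integral_neg_eq_self (fun ξ : ℝ => 𝓕 F ξ * e (ξ * N)) _
    _ = 𝓕⁻ (𝓕 F) N := by
        rw [Real.fourierInv_eq']
        congr 1 with ξ
        rw [smul_eq_mul, mul_comm, e]
        congr 2
        simp only [RCLike.inner_apply, conj_trivial]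
        push_cast
        ring
    _ = _ := by
        rw [hF.fourierInv_fourier_eq hN0 hFi hFint, Complex.ofReal_mul, mul_one_div]
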